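/- Let Ω ⊂ ℝ^N be a bounded open set, let λ, γ > 0, and let f, g : ℝ → ℝ be C² functions with f ≥ 0, g ≥ 0, f' ≥ 0, g' ≥ 0, f'' ≥ 0, g'' ≥ 0 everywhere. Let u, v : ℝ^N → ℝ be continuous on the closure of Ω. Suppose there exist C² functions ζ, χ on Ω with ζ > 0 and χ > 0 on Ω such that in Ω: −Δζ ≥ λ f'(u) g'(v) ζ + λ f(u) g''(v) χ and −Δχ ≥ γ f''(u) g(v) ζ + γ f'(u) g'(v) χ. Then for every pair of smooth compactly supported functions φ, ψ : Ω → ℝ one has ∫_Ω f'(u) g'(v) (φ² + ψ²) + 2 ∫_Ω √(f(u) f''(u) g(v) g''(v)) φ ψ ≤ (1/λ) ∫_Ω |∇φ|² + (1/γ) ∫_Ω |∇ψ|². -/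

import Mathlib

open MeasureTheory Real Set Filter Topology

/-- The Euclidean Laplacian: the trace of the second derivative. -/
noncomputable def lapl {N : ℕ} (f : EuclideanSpace ℝ (Fin N) → ℝ)
    (x : EuclideanSpace ℝ (Fin N)) : ℝ :=
  ∑ i : Fin N, iteratedFDeriv ℝ 2 f x ![EuclideanSpace.single i 1, EuclideanSpace.single i 1]

/-- A function continuous on an open set, times a continuous function compactly supported in that
set, is integrable. -/
theorem integrable_mul_of_tsupport_subset {N : ℕ} {Ω : Set (EuclideanSpace ℝ (Fin N))}
    (hΩ : IsOpen Ω) {h k : EuclideanSpace ℝ (Fin N) → ℝ} (hh : ContinuousOn h Ω)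
    (hk : Continuous k) (hkc : HasCompactSupport k) (hkΩ : tsupport k ⊆ Ω) :
    Integrable (fun x => h x * k x) := by
  refine Continuous.integrable_of_hasCompactSupport ?_ hkc.mul_left
  refine continuous_of_tsupport fun x hx => ?_
  exact ((hh.mul hk.continuousOn).continuousAt
    (hΩ.mem_nhds (hkΩ (tsupport_mul_subset_right hx))))

/-- The derivative of a `C¹` compactly supported function integrates to zero in any direction. -/
theorem integral_fderiv_apply_eq_zero {N : ℕ} {F : EuclideanSpace ℝ (Fin N) → ℝ}
    (hF : ContDiff ℝ 1 F) (hFc : HasCompactSupport F) (e : EuclideanSpace ℝ (Fin N)) :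
    Integrable (fun x => fderiv ℝ F x e) ∧ ∫ x, fderiv ℝ F x e = 0 := by
  have hint : Integrable (fun x => fderiv ℝ F x e) :=
    ((hF.continuous_fderiv one_ne_zero).clm_apply
      continuous_const).integrable_of_hasCompactSupport (hFc.fderiv_apply ℝ e)
  refine ⟨hint, ?_⟩
  have key := integral_mul_fderiv_eq_neg_fderiv_mul_of_integrable (𝕜 := ℝ) (μ := volume)
    (f := fun _ : EuclideanSpace ℝ (Fin N) => (1 : ℝ)) (g := F) (v := e)
    (by simp) (by simpa using hint)
    (by simpa using hF.continuous.integrable_of_hasCompactSupport hFc)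
    (fun _ _ => differentiableAt_const _)
    (fun x _ => (hF.differentiable one_ne_zero) x)
  simpa using key

/-- The squared norm of the gradient is the sum of the squared partial derivatives. -/
theorem norm_gradient_sq {N : ℕ} (φ : EuclideanSpace ℝ (Fin N) → ℝ)
    (x : EuclideanSpace ℝ (Fin N)) :
    ‖gradient φ x‖ ^ 2 = ∑ i, fderiv ℝ φ x (EuclideanSpace.single i 1) ^ 2 := by
  rw [EuclideanSpace.norm_sq_eq]
  refine Finset.sum_congr rfl fun i _ => ?_
  rw [← toDual_gradient, InnerProductSpace.toDual_apply_apply, EuclideanSpace.inner_single_right]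
  simp

/-- Picone's inequality in divergence form: for positive `ζ`, the function `-(Δζ / ζ) φ²` is at
most `|∇φ|²` up to a divergence with zero integral. -/
theorem exists_neg_lapl_div_mul_sq_le {N : ℕ} {Ω : Set (EuclideanSpace ℝ (Fin N))}
    (hΩ : IsOpen Ω) {ζ φ : EuclideanSpace ℝ (Fin N) → ℝ} (hζ : ContDiffOn ℝ 2 ζ Ω)
    (hζpos : ∀ x ∈ Ω, 0 < ζ x) (hφ : ContDiff ℝ 1 φ) (hφc : HasCompactSupport φ)
    (hφΩ : tsupport φ ⊆ Ω) :
    ∃ D : EuclideanSpace ℝ (Fin N) → ℝ, IntegrableOn D Ω ∧ ∫ x in Ω, D x = 0 ∧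
      ∀ x ∈ Ω, -lapl ζ x / ζ x * φ x ^ 2 ≤ ‖gradient φ x‖ ^ 2 - D x := by
  let e : Fin N → EuclideanSpace ℝ (Fin N) := fun i => EuclideanSpace.single i 1
  let F : Fin N → EuclideanSpace ℝ (Fin N) → ℝ :=
    fun i x => φ x ^ 2 * (fderiv ℝ ζ x (e i) * (ζ x)⁻¹)
  have hsupp : ∀ i, tsupport (F i) ⊆ tsupport φ := fun i =>
    closure_mono fun x hx hφx => hx (by simp [F, hφx])
  have hFc : ∀ i, HasCompactSupport (F i) := fun i =>
    hφc.of_isClosed_subset (isClosed_tsupport _) (hsupp i)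
  have hdζ : ∀ x ∈ Ω, ContDiffAt ℝ 1 (fderiv ℝ ζ) x := fun x hx =>
    (hζ.contDiffAt (hΩ.mem_nhds hx)).fderiv_right (by norm_num)
  have hF : ∀ i, ContDiff ℝ 1 (F i) := by
    intro i
    refine contDiff_iff_contDiffAt.2 fun x => ?_
    by_cases hx : x ∈ tsupport (F i)
    swap
    · exact contDiffAt_const.congr_of_eventuallyEq (notMem_tsupport_iff_eventuallyEq.1 hx)
    have hx' : x ∈ Ω := hφΩ (hsupp i hx)
    exact (hφ.contDiffAt.pow 2).mul (((hdζ x hx').clm_apply contDiffAt_const).mul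
      (((hζ.contDiffAt (hΩ.mem_nhds hx')).of_le (by norm_num)).inv (hζpos x hx').ne'))
  have hI := fun i => integral_fderiv_apply_eq_zero (hF i) (hFc i) (e i)
  refine ⟨fun x => ∑ i, fderiv ℝ (F i) x (e i),
    (integrable_finsetSum _ fun i _ => (hI i).1).integrableOn, ?_, ?_⟩
  · rw [setIntegral_eq_integral_of_forall_compl_eq_zero,
      integral_finsetSum _ fun i _ => (hI i).1]
    · exact Finset.sum_eq_zero fun i _ => (hI i).2
    · intro x hx
      refine Finset.sum_eq_zero fun i _ => ?_
      rw [fderiv_of_notMem_tsupport ℝ fun h => hx (hφΩ (hsupp i h))]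
      simp
  · intro x hx
    have hpos := hζpos x hx
    have hFd : ∀ i, fderiv ℝ (F i) x (e i) =
        2 * φ x * fderiv ℝ φ x (e i) * (fderiv ℝ ζ x (e i) / ζ x)
          + φ x ^ 2 * (fderiv ℝ (fderiv ℝ ζ) x (e i) (e i) / ζ x)
          - φ x ^ 2 * (fderiv ℝ ζ x (e i) / ζ x) ^ 2 := by
      intro i
      have h1 := (hφ.differentiable one_ne_zero x).hasFDerivAt.pow 2
      have h2 := ((hdζ x hx).differentiableAt one_ne_zero).hasFDerivAt.clm_apply
        (hasFDerivAt_const (e i) x)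
      have h3 := (hasDerivAt_inv hpos.ne').comp_hasFDerivAt x
        ((hζ.contDiffAt (hΩ.mem_nhds hx)).differentiableAt two_ne_zero).hasFDerivAt
      have h4 := (h1.mul (h2.mul h3)).fderiv
      refine (congrArg (fun L => L (e i)) h4).trans ?_
      simp
      field_simp
      ring
    rw [norm_gradient_sq, ← Finset.sum_sub_distrib]
    simp only [lapl, iteratedFDeriv_two_apply, neg_div, Finset.sum_div, neg_mul, Finset.sum_mul]
    rw [← Finset.sum_neg_distrib]
    refine Finset.sum_le_sum fun i _ => ?_
    rw [hFd i]
    simp only [Matrix.cons_val_zero, Matrix.cons_val_one]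
    change -(fderiv ℝ (fderiv ℝ ζ) x (e i) (e i) / ζ x * φ x ^ 2) ≤ fderiv ℝ φ x (e i) ^ 2 - _
    nlinarith [sq_nonneg (fderiv ℝ φ x (e i) - φ x * (fderiv ℝ ζ x (e i) / ζ x))]

/-- The weighted arithmetic-geometric mean inequality `2 √(BC) p q ≤ (z/y) B p² + (y/z) C q²`. -/
theorem two_mul_sqrt_mul_le {B C y z : ℝ} (hB : 0 ≤ B) (hC : 0 ≤ C) (hy : 0 < y) (hz : 0 < z)
    (p q : ℝ) :
    2 * (√(B * C) * p * q) ≤ B * z / y * p ^ 2 + C * y / z * q ^ 2 := by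
  have h1 : 0 ≤ B * z / y := by positivity
  have h2 : 0 ≤ C * y / z := by positivity
  have h : √(B * C) = √(B * z / y) * √(C * y / z) := by
    rw [← Real.sqrt_mul h1]
    congr 1
    field_simp
  rw [h]
  nlinarith [sq_nonneg (√(B * z / y) * p - √(C * y / z) * q), Real.sq_sqrt h1, Real.sq_sqrt h2]

/-- Stability inequality for semi-stable solutions of the Hamiltonian system `(H)_{λ,γ}`. -/
theorem stmt_1 {N : ℕ} (Ω : Set (EuclideanSpace ℝ (Fin N)))
    (hΩo : IsOpen Ω) (hΩb : Bornology.IsBounded Ω)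
    (lam gam : ℝ) (hlam : 0 < lam) (hgam : 0 < gam)
    (f g : ℝ → ℝ) (hf : ContDiff ℝ 2 f) (hg : ContDiff ℝ 2 g)
    (hf0 : ∀ s : ℝ, 0 ≤ f s) (hg0 : ∀ s : ℝ, 0 ≤ g s)
    (hf' : ∀ s : ℝ, 0 ≤ deriv f s) (hg' : ∀ s : ℝ, 0 ≤ deriv g s)
    (hf'' : ∀ s : ℝ, 0 ≤ deriv (deriv f) s) (hg'' : ∀ s : ℝ, 0 ≤ deriv (deriv g) s)
    (u v : EuclideanSpace ℝ (Fin N) → ℝ)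
    (hu : ContinuousOn u (closure Ω)) (hv : ContinuousOn v (closure Ω))
    (ζ χ : EuclideanSpace ℝ (Fin N) → ℝ)
    (hζ : ContDiffOn ℝ 2 ζ Ω) (hχ : ContDiffOn ℝ 2 χ Ω)
    (hζpos : ∀ x ∈ Ω, 0 < ζ x) (hχpos : ∀ x ∈ Ω, 0 < χ x)
    (hstab1 : ∀ x ∈ Ω,
      lam * deriv f (u x) * deriv g (v x) * ζ x
        + lam * f (u x) * deriv (deriv g) (v x) * χ x ≤ - lapl ζ x)
    (hstab2 : ∀ x ∈ Ω,
      gam * deriv (deriv f) (u x) * g (v x) * ζ x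
        + gam * deriv f (u x) * deriv g (v x) * χ x ≤ - lapl χ x)
    (φ ψ : EuclideanSpace ℝ (Fin N) → ℝ)
    (hφ : ContDiff ℝ (⊤ : ℕ∞) φ) (hψ : ContDiff ℝ (⊤ : ℕ∞) ψ)
    (hφc : HasCompactSupport φ) (hψc : HasCompactSupport ψ)
    (hφΩ : tsupport φ ⊆ Ω) (hψΩ : tsupport ψ ⊆ Ω) :
    (∫ x in Ω, deriv f (u x) * deriv g (v x) * (φ x ^ 2 + ψ x ^ 2))
      + 2 * ∫ x in Ω,
          Real.sqrt (f (u x) * deriv (deriv f) (u x) * g (v x) * deriv (deriv g) (v x))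
            * φ x * ψ x
    ≤ (1 / lam) * (∫ x in Ω, ‖gradient φ x‖ ^ 2)
      + (1 / gam) * ∫ x in Ω, ‖gradient ψ x‖ ^ 2 := by
  have hf2 : ContDiff ℝ 1 (deriv f) := ((contDiff_succ_iff_deriv (n := 1)).1 hf).2.2
  have hg2 : ContDiff ℝ 1 (deriv g) := ((contDiff_succ_iff_deriv (n := 1)).1 hg).2.2
  have hf3 : Continuous (deriv (deriv f)) := hf2.continuous_deriv le_rfl
  have hg3 : Continuous (deriv (deriv g)) := hg2.continuous_deriv le_rfl
  have huΩ := hu.mono subset_closure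
  have hvΩ := hv.mono subset_closure
  have hφ1 : ContDiff ℝ 1 φ := hφ.of_le (by exact_mod_cast le_top)
  have hψ1 : ContDiff ℝ 1 ψ := hψ.of_le (by exact_mod_cast le_top)
  obtain ⟨D, hDi, hD0, hD⟩ := exists_neg_lapl_div_mul_sq_le hΩo hζ hζpos hφ1 hφc hφΩ
  obtain ⟨E, hEi, hE0, hE⟩ := exists_neg_lapl_div_mul_sq_le hΩo hχ hχpos hψ1 hψc hψΩ
  have hgrad : ∀ {θ : EuclideanSpace ℝ (Fin N) → ℝ}, ContDiff ℝ 1 θ → HasCompactSupport θ →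
      IntegrableOn (fun x => ‖gradient θ x‖ ^ 2) Ω := by
    intro θ hθ hθc
    simp only [norm_gradient_sq]
    refine (integrable_finsetSum _ fun i _ => ?_).integrableOn
    refine Continuous.integrable_of_hasCompactSupport
      (((hθ.continuous_fderiv one_ne_zero).clm_apply continuous_const).pow 2) ?_
    exact (hθc.fderiv_apply ℝ (EuclideanSpace.single i 1)).comp_left
      (g := fun t : ℝ => t ^ 2) (by simp)
  have hφi := hgrad hφ1 hφc
  have hψi := hgrad hψ1 hψc
  have hA : ContinuousOn (fun x => deriv f (u x) * deriv g (v x)) Ω :=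
    (hf2.continuous.comp_continuousOn huΩ).mul (hg2.continuous.comp_continuousOn hvΩ)
  have hS : ContinuousOn (fun x =>
      √(f (u x) * deriv (deriv f) (u x) * g (v x) * deriv (deriv g) (v x))) Ω :=
    ((((hf.continuous.comp_continuousOn huΩ).mul (hf3.comp_continuousOn huΩ)).mul
      (hg.continuous.comp_continuousOn hvΩ)).mul (hg3.comp_continuousOn hvΩ)).sqrt
  have hsq : ∀ {θ : EuclideanSpace ℝ (Fin N) → ℝ}, Continuous θ → HasCompactSupport θ →
      tsupport θ ⊆ Ω →
      IntegrableOn (fun x => deriv f (u x) * deriv g (v x) * θ x ^ 2) Ω := by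
    intro θ hθ hθc hθΩ
    have hsub : tsupport (fun x => θ x ^ 2) ⊆ tsupport θ :=
      closure_mono fun x hx hx0 => hx (by simp [hx0])
    exact (integrable_mul_of_tsupport_subset hΩo hA (hθ.pow 2)
      (hθc.of_isClosed_subset (isClosed_tsupport _) hsub) (hsub.trans hθΩ)).integrableOn
  have hAi : IntegrableOn
      (fun x => deriv f (u x) * deriv g (v x) * (φ x ^ 2 + ψ x ^ 2)) Ω := by
    simp only [mul_add]
    exact (hsq hφ.continuous hφc hφΩ).add (hsq hψ.continuous hψc hψΩ)
  have hSi : IntegrableOn (fun x =>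
      √(f (u x) * deriv (deriv f) (u x) * g (v x) * deriv (deriv g) (v x)) * φ x * ψ x) Ω :=
    (integrable_mul_of_tsupport_subset hΩo (hS.mul hφ.continuous.continuousOn)
      hψ.continuous hψc hψΩ).integrableOn
  have hφD : IntegrableOn (fun x => 1 / lam * (‖gradient φ x‖ ^ 2 - D x)) Ω :=
    (hφi.sub hDi).const_mul _
  have hψE : IntegrableOn (fun x => 1 / gam * (‖gradient ψ x‖ ^ 2 - E x)) Ω :=
    (hψi.sub hEi).const_mul _
  have hφD0 : ∫ x in Ω, 1 / lam * (‖gradient φ x‖ ^ 2 - D x) =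
      1 / lam * ∫ x in Ω, ‖gradient φ x‖ ^ 2 := by
    rw [integral_const_mul, integral_sub hφi hDi, hD0, sub_zero]
  have hψE0 : ∫ x in Ω, 1 / gam * (‖gradient ψ x‖ ^ 2 - E x) =
      1 / gam * ∫ x in Ω, ‖gradient ψ x‖ ^ 2 := by
    rw [integral_const_mul, integral_sub hψi hEi, hE0, sub_zero]
  rw [← integral_const_mul, ← integral_add hAi (hSi.const_mul 2), ← hφD0, ← hψE0,
    ← integral_add hφD hψE]
  refine setIntegral_mono_on (hAi.add (hSi.const_mul 2)) (hφD.add hψE) hΩo.measurableSet ?_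
  intro x hx
  have hζx := hζpos x hx
  have hχx := hχpos x hx
  have hamgm := two_mul_sqrt_mul_le (mul_nonneg (hf0 (u x)) (hg'' (v x)))
    (mul_nonneg (hf'' (u x)) (hg0 (v x))) hζx hχx (φ x) (ψ x)
  have hreorder : f (u x) * deriv (deriv f) (u x) * g (v x) * deriv (deriv g) (v x) =
      f (u x) * deriv (deriv g) (v x) * (deriv (deriv f) (u x) * g (v x)) := by ring
  have h1 : deriv f (u x) * deriv g (v x) + f (u x) * deriv (deriv g) (v x) * χ x / ζ x ≤
      1 / lam * (-lapl ζ x / ζ x) := by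
    have := hstab1 x hx
    field_simp
    linarith
  have h2 : deriv f (u x) * deriv g (v x) + deriv (deriv f) (u x) * g (v x) * ζ x / χ x ≤
      1 / gam * (-lapl χ x / χ x) := by
    have := hstab2 x hx
    field_simp
    linarith
  have h3 := mul_le_mul_of_nonneg_right h1 (sq_nonneg (φ x))
  have h4 := mul_le_mul_of_nonneg_right h2 (sq_nonneg (ψ x))
  have h5 := mul_le_mul_of_nonneg_left (hD x hx) (one_div_pos.2 hlam).le
  have h6 := mul_le_mul_of_nonneg_left (hE x hx) (one_div_pos.2 hgam).le
  rw [hreorder]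
  linarith
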